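/- Let d ≥ 1, γ > 0, let f : ℝ → ℝ be twice continuously differentiable, let m, η : ℝ → ℝ be continuously differentiable with m ≥ 0 and η ≥ 0, and let φ, μ, p : ℝ × ℝ^d → ℝ and v : ℝ × ℝ^d → ℝ^d be smooth and ℤ^d-periodic in the spatial variable. Suppose the Cahn–Hilliard–Navier–Stokes system holds on ℝ × ℝ^d: ∂_t φ + div(φ v) = div( m(φ) ∇μ ), μ = −γ Δφ + f′(φ), ∂_t v + div(v ⊗ v) − div( η(φ) D v ) + ∇p + div( γ ∇φ ⊗ ∇φ ) = 0, and div(v) = 0, where D v = ½(∇v + (∇v)ᵀ). Then for every t the total energy E₁(φ(t), v(t)) = ∫_Ω ( (γ/2)|∇φ|² + f(φ) + ½|v|² ) dx over the unit cube Ω = [0,1]^d satisfies d/dt E₁(φ(t), v(t)) = − ∫_Ω m(φ) |∇μ|² dx − ∫_Ω η(φ) |D v|² dx ≤ 0. -/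

import Mathlib

open MeasureTheory

/-- The `i`-th partial derivative of a function `g : ℝ^d → ℝ`. -/
noncomputable def pderiv {d : ℕ} (g : (Fin d → ℝ) → ℝ) (i : Fin d) (x : Fin d → ℝ) : ℝ :=
  fderiv ℝ g x (Pi.single i 1)

/-- `ℤ^d`-periodicity of a function on `ℝ^d`. -/
def ZdPeriodic {d : ℕ} {E : Type*} (g : (Fin d → ℝ) → E) : Prop :=
  ∀ (x : Fin d → ℝ) (k : Fin d → ℤ), g (x + fun i => (k i : ℝ)) = g x

/-- The symmetric gradient `(Dv)_{ij} = ½(∂_j v_i + ∂_i v_j)` of a vector field. -/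
noncomputable def symGrad {d : ℕ} (v : (Fin d → ℝ) → Fin d → ℝ)
    (i j : Fin d) (x : Fin d → ℝ) : ℝ :=
  1 / 2 * (pderiv (fun y => v y i) j x + pderiv (fun y => v y j) i x)

theorem energy_balance_algebra {d : ℕ} (γ m η φ φt μ f' q : ℝ) (a φt' b N V Vt P : Fin d → ℝ)
    (H W S D : Fin d → Fin d → ℝ)
    (hH : ∀ i j, H i j = H j i) (hD : ∀ i j, D i j = 1 / 2 * (W i j + W j i))
    (hpde : φt + ∑ i, (a i * V i + φ * W i i) = ∑ i, N i)
    (hchem : μ = -γ * ∑ i, H i i + f')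
    (hmom : ∀ i, Vt i + ∑ j, (W i j * V j + V i * W j j) - ∑ j, S i j + P i +
      ∑ j, γ * (H i j * a j + a i * H j j) = 0)
    (hdiv : ∑ i, W i i = 0) :
    γ * ∑ i, a i * φt' i + f' * φt + ∑ i, V i * Vt i =
      -(m * ∑ i, b i ^ 2) - η * ∑ i, ∑ j, D i j ^ 2 +
      ∑ j, (γ * (φt' j * a j + φt * H j j) + (b j * (m * b j) + μ * N j) +
        ∑ i, (W i j * (η * D i j) + V i * S i j) -
        (W j j * q + V j * (∑ i, V i * W i j + P j + γ * ∑ i, a i * H i j + f' * a j))) := by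
  have hVt : ∀ i, V i * Vt i = -∑ j, V i * W i j * V j - V i ^ 2 * ∑ j, W j j +
      ∑ j, V i * S i j - V i * P i - γ * ∑ j, V i * (H i j * a j) -
      γ * (V i * a i) * ∑ j, H j j := by
    intro i
    have h := hmom i
    simp only [Finset.sum_add_distrib, ← Finset.mul_sum, mul_assoc] at h ⊢
    linear_combination V i * h
  have hDD : ∑ i, ∑ j, W i j * D i j = ∑ i, ∑ j, D i j ^ 2 := by
    have h1 : ∑ i, ∑ j, W i j * D i j = ∑ i, ∑ j, W j i * D i j := by
      rw [Finset.sum_comm]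
      refine Finset.sum_congr rfl fun i _ => Finset.sum_congr rfl fun j _ => ?_
      rw [hD, hD i j]; ring
    have h2 : ∑ i, ∑ j, D i j ^ 2 =
        1 / 2 * (∑ i, ∑ j, W i j * D i j + ∑ i, ∑ j, W j i * D i j) := by
      simp only [← Finset.sum_add_distrib, Finset.mul_sum]
      refine Finset.sum_congr rfl fun i _ => Finset.sum_congr rfl fun j _ => ?_
      rw [pow_two]; nth_rw 1 [hD]; ring
    rw [h2, ← h1]; ring
  have e1 : ∑ j, ∑ i, (W i j * (η * D i j) + V i * S i j) =
      η * ∑ i, ∑ j, D i j ^ 2 + ∑ i, ∑ j, V i * S i j := by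
    rw [← hDD, Finset.sum_comm]
    simp only [Finset.sum_add_distrib, Finset.mul_sum]
    congr 1
    refine Finset.sum_congr rfl fun i _ => Finset.sum_congr rfl fun j _ => ?_
    ring
  have e2 : ∑ j, V j * ∑ i, V i * W i j = ∑ i, ∑ j, V i * W i j * V j := by
    rw [Finset.sum_comm]
    refine Finset.sum_congr rfl fun i _ => ?_
    rw [Finset.mul_sum]
    exact Finset.sum_congr rfl fun j _ => by ring
  have e3 : ∑ j, V j * (γ * ∑ i, a i * H i j) = γ * ∑ i, ∑ j, V i * (H i j * a j) := by
    rw [Finset.mul_sum]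
    refine Finset.sum_congr rfl fun i _ => ?_
    simp only [Finset.mul_sum]
    refine Finset.sum_congr rfl fun j _ => ?_
    rw [hH i j]; ring
  have e4 : ∑ j, V j * (f' * a j) = f' * ∑ i, V i * a i := by
    rw [Finset.mul_sum]; exact Finset.sum_congr rfl fun j _ => by ring
  have e5 : ∑ j, γ * (V j * a j) * ∑ k, H k k = γ * (∑ i, V i * a i) * ∑ k, H k k := by
    rw [← Finset.sum_mul, ← Finset.mul_sum]
  have e6 : ∑ j, γ * (φt' j * a j + φt * H j j) =
      γ * ∑ i, a i * φt' i + γ * φt * ∑ k, H k k := by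
    simp only [Finset.mul_sum, ← Finset.sum_add_distrib]
    exact Finset.sum_congr rfl fun j _ => by ring
  have e7 : ∑ j, (b j * (m * b j) + μ * N j) = m * ∑ i, b i ^ 2 + μ * ∑ i, N i := by
    simp only [Finset.mul_sum, ← Finset.sum_add_distrib]
    exact Finset.sum_congr rfl fun j _ => by ring
  have e8 : ∑ i, (a i * V i + φ * W i i) = ∑ i, V i * a i := by
    rw [Finset.sum_add_distrib, ← Finset.mul_sum, hdiv, mul_zero, add_zero]
    exact Finset.sum_congr rfl fun j _ => mul_comm _ _
  rw [e8] at hpde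
  have eL : ∑ i, V i * Vt i = -∑ i, ∑ j, V i * W i j * V j + ∑ i, ∑ j, V i * S i j -
      ∑ i, V i * P i - γ * ∑ i, ∑ j, V i * (H i j * a j) -
      γ * (∑ i, V i * a i) * ∑ k, H k k := by
    rw [← e5, Finset.sum_congr rfl fun i _ => hVt i]
    simp only [hdiv, mul_zero, sub_zero, Finset.sum_add_distrib, Finset.sum_sub_distrib,
      Finset.sum_neg_distrib, ← Finset.mul_sum]
  have eR : ∑ j, (γ * (φt' j * a j + φt * H j j) + (b j * (m * b j) + μ * N j) +
        ∑ i, (W i j * (η * D i j) + V i * S i j) -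
        (W j j * q + V j * (∑ i, V i * W i j + P j + γ * ∑ i, a i * H i j + f' * a j))) =
      γ * ∑ i, a i * φt' i + γ * φt * ∑ k, H k k + (m * ∑ i, b i ^ 2 + μ * ∑ i, N i) +
      (η * ∑ i, ∑ j, D i j ^ 2 + ∑ i, ∑ j, V i * S i j) -
      (∑ i, ∑ j, V i * W i j * V j + ∑ i, V i * P i + γ * ∑ i, ∑ j, V i * (H i j * a j) +
        f' * ∑ i, V i * a i) := by
    rw [← e1, ← e2, ← e3, ← e4, ← e6, ← e7]
    have e9 : ∑ j, W j j * q = 0 := by rw [← Finset.sum_mul, hdiv, zero_mul]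
    simp only [Finset.sum_sub_distrib, Finset.sum_add_distrib, mul_add, e9, zero_add]
  rw [eL, eR, ← hpde, hchem]
  ring

open scoped ContDiff

section pderiv

variable {d : ℕ} {g h : (Fin d → ℝ) → ℝ} {x : Fin d → ℝ}

theorem ContDiff.pderiv_infty (hg : ContDiff ℝ ∞ g) (i : Fin d) : ContDiff ℝ ∞ (pderiv g i) :=
  (hg.fderiv_right (m := ∞) (by simp)).clm_apply contDiff_const

theorem pderiv_add (hg : DifferentiableAt ℝ g x) (hh : DifferentiableAt ℝ h x) (i : Fin d) :
    pderiv (fun y => g y + h y) i x = pderiv g i x + pderiv h i x := by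
  simp [pderiv, fderiv_fun_add hg hh]

theorem pderiv_sub (hg : DifferentiableAt ℝ g x) (hh : DifferentiableAt ℝ h x) (i : Fin d) :
    pderiv (fun y => g y - h y) i x = pderiv g i x - pderiv h i x := by
  simp [pderiv, fderiv_fun_sub hg hh]

theorem pderiv_mul (hg : DifferentiableAt ℝ g x) (hh : DifferentiableAt ℝ h x) (i : Fin d) :
    pderiv (fun y => g y * h y) i x = pderiv g i x * h x + g x * pderiv h i x := by
  simp [pderiv, fderiv_fun_mul hg hh]
  ring

theorem pderiv_const_mul (hg : DifferentiableAt ℝ g x) (c : ℝ) (i : Fin d) :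
    pderiv (fun y => c * g y) i x = c * pderiv g i x := by
  simp [pderiv, fderiv_const_mul hg]

theorem pderiv_sum {ι : Type*} {s : Finset ι} {G : ι → (Fin d → ℝ) → ℝ}
    (hG : ∀ k ∈ s, DifferentiableAt ℝ (G k) x) (i : Fin d) :
    pderiv (fun y => ∑ k ∈ s, G k y) i x = ∑ k ∈ s, pderiv (G k) i x := by
  simp [pderiv, fderiv_fun_sum hG]

theorem pderiv_pow_two (hg : DifferentiableAt ℝ g x) (i : Fin d) :
    pderiv (fun y => g y ^ 2) i x = 2 * (g x * pderiv g i x) := by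
  simp only [pow_two]
  rw [pderiv_mul hg hg]
  ring

theorem pderiv_comp {f : ℝ → ℝ} (hf : DifferentiableAt ℝ f (g x)) (hg : DifferentiableAt ℝ g x)
    (i : Fin d) : pderiv (fun y => f (g y)) i x = deriv f (g x) * pderiv g i x := by
  have := (hf.hasDerivAt.comp_hasFDerivAt x hg.hasFDerivAt).fderiv
  simp only [Function.comp_def] at this
  simp [pderiv, this]

theorem pderiv_comm (hg : ContDiff ℝ ∞ g) (i j : Fin d) :
    pderiv (pderiv g i) j x = pderiv (pderiv g j) i x := by
  have hd : DifferentiableAt ℝ (fderiv ℝ g) x :=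
    (hg.fderiv_right (m := ∞) (by simp)).differentiable (by simp) x
  have hs : IsSymmSndFDerivAt ℝ g x := hg.contDiffAt.isSymmSndFDerivAt
    (by simpa using WithTop.coe_le_coe.2 (le_top : (2 : ℕ∞) ≤ ⊤))
  have key : ∀ i j, pderiv (pderiv g i) j x =
      fderiv ℝ (fderiv ℝ g) x (Pi.single j 1) (Pi.single i 1) := by
    intro i j
    have := (hd.hasFDerivAt.clm_apply (hasFDerivAt_const (Pi.single i (1 : ℝ)) x)).fderiv
    change fderiv ℝ (fun y => fderiv ℝ g y (Pi.single i 1)) x (Pi.single j 1) = _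
    simp [this]
  rw [key, key]
  exact hs _ _

theorem ZdPeriodic.pderiv (hg : ZdPeriodic g) (i : Fin d) : ZdPeriodic (pderiv g i) := by
  intro x k
  have : g = fun y => g (y + fun i => (k i : ℝ)) := funext fun y => (hg y k).symm
  unfold _root_.pderiv
  conv_rhs => rw [this, fderiv_comp_add_right]

end pderiv

theorem integral_divergence_eq_zero {d : ℕ} {F : Fin d → (Fin d → ℝ) → ℝ}
    (hF : ∀ i, ContDiff ℝ 1 (F i)) (hper : ∀ i, ZdPeriodic (F i)) :
    ∫ x in Set.Icc (0 : Fin d → ℝ) 1, ∑ i, pderiv (F i) i x = 0 := by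
  cases d with
  | zero => simp
  | succ n =>
    have hc : Continuous fun x => ∑ i, pderiv (F i) i x :=
      continuous_finsetSum _ fun i _ =>
        ((hF i).continuous_fderiv (by simp)).clm_apply continuous_const
    refine (integral_divergence_of_hasFDerivAt_off_countable' (0 : Fin (n + 1) → ℝ) 1
      zero_le_one F (fun i => fderiv ℝ (F i)) ∅ Set.countable_empty
      (fun i => (hF i).continuous.continuousOn)
      (fun x _ i => ((hF i).differentiable (by simp) x).hasFDerivAt)
      (hc.continuousOn.integrableOn_compact isCompact_Icc)).trans ?_
    refine Finset.sum_eq_zero fun i _ => sub_eq_zero.2 ?_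
    congr 1
    funext y
    rw [← hper i (i.insertNth ((0 : Fin (n + 1) → ℝ) i) y) (Pi.single i 1)]
    congr 1
    funext j
    refine Fin.succAboveCases i ?_ (fun k => ?_) j <;> simp

theorem hasDerivAt_setIntegral_of_contDiff {E : Type*} [NormedAddCommGroup E] [NormedSpace ℝ E]
    [MeasurableSpace E] [BorelSpace E] [SecondCountableTopology E] {ν : Measure E}
    [IsFiniteMeasureOnCompacts ν] {G : ℝ × E → ℝ} (hG : ContDiff ℝ 1 G) {K : Set E}
    (hK : IsCompact K) (t : ℝ) :
    HasDerivAt (fun s => ∫ x in K, G (s, x) ∂ν) (∫ x in K, deriv (fun s => G (s, x)) t ∂ν) t := by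
  have hderiv : ∀ s x, HasDerivAt (fun s => G (s, x)) (fderiv ℝ G (s, x) (1, 0)) s := fun s x =>
    ((hG.differentiable (by simp)) (s, x)).hasFDerivAt.comp_hasDerivAt s
      ((hasDerivAt_id s).prodMk (hasDerivAt_const s x))
  have hcont : Continuous fun q : ℝ × E => fderiv ℝ G q (1, 0) :=
    (hG.continuous_fderiv (by simp)).clm_apply continuous_const
  obtain ⟨C, hC⟩ := ((isCompact_closedBall t 1).prod hK).exists_bound_of_continuousOn
    hcont.continuousOn
  have hint : ∀ s, IntegrableOn (fun x => G (s, x)) K ν := fun s =>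
    (hG.continuous.comp (by fun_prop : Continuous fun x : E => (s, x))).continuousOn
      |>.integrableOn_compact hK
  have hint' : IntegrableOn (fun x => fderiv ℝ G (t, x) (1, 0)) K ν :=
    (hcont.comp (by fun_prop : Continuous fun x : E => (t, x))).continuousOn
      |>.integrableOn_compact hK
  have := (hasDerivAt_integral_of_dominated_loc_of_deriv_le (μ := ν.restrict K)
    (F := fun s x => G (s, x)) (F' := fun s x => fderiv ℝ G (s, x) (1, 0)) (bound := fun _ => C)
    (Metric.closedBall_mem_nhds t one_pos)
    (Filter.Eventually.of_forall fun s => (hint s).aestronglyMeasurable) (hint t)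
    hint'.aestronglyMeasurable
    ((ae_restrict_iff' hK.measurableSet).2 <| .of_forall fun x hx s hs => hC (s, x) ⟨hs, hx⟩)
    (by
      have : IsFiniteMeasure (ν.restrict K) := ⟨by simpa using hK.measure_lt_top⟩
      exact integrable_const C)
    (.of_forall fun x s _ => hderiv s x)).2
  simpa only [(hderiv t _).deriv] using this

section time

variable {d : ℕ} {Φ : ℝ × (Fin d → ℝ) → ℝ}

theorem pderiv_slice (hΦ : ContDiff ℝ ∞ Φ) (s : ℝ) (x : Fin d → ℝ) (i : Fin d) :
    pderiv (fun z => Φ (s, z)) i x = fderiv ℝ Φ (s, x) (0, Pi.single i 1) := by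
  have := (((hΦ.differentiable (by simp)) (s, x)).hasFDerivAt.comp x
    ((hasFDerivAt_const s x).prodMk (hasFDerivAt_id x))).fderiv
  simp only [Function.comp_def] at this
  simp [pderiv, this]

theorem hasDerivAt_slice (hΦ : ContDiff ℝ ∞ Φ) (s : ℝ) (x : Fin d → ℝ) :
    HasDerivAt (fun s => Φ (s, x)) (fderiv ℝ Φ (s, x) (1, 0)) s :=
  ((hΦ.differentiable (by simp)) (s, x)).hasFDerivAt.comp_hasDerivAt s
    ((hasDerivAt_id s).prodMk (hasDerivAt_const s x))

theorem contDiff_fderiv_apply_const (hΦ : ContDiff ℝ ∞ Φ) (w : ℝ × (Fin d → ℝ)) :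
    ContDiff ℝ ∞ fun q => fderiv ℝ Φ q w :=
  (hΦ.fderiv_right (m := ∞) (by simp)).clm_apply contDiff_const

theorem contDiff_deriv_slice (hΦ : ContDiff ℝ ∞ Φ) (t : ℝ) :
    ContDiff ℝ ∞ fun x => deriv (fun s => Φ (s, x)) t := by
  simp only [(hasDerivAt_slice hΦ t _).deriv]
  exact (contDiff_fderiv_apply_const hΦ _).comp (contDiff_const.prodMk contDiff_id)

theorem hasDerivAt_pderiv_slice (hΦ : ContDiff ℝ ∞ Φ) (t : ℝ) (x : Fin d → ℝ) (i : Fin d) :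
    HasDerivAt (fun s => pderiv (fun z => Φ (s, z)) i x)
      (pderiv (fun y => deriv (fun s => Φ (s, y)) t) i x) t := by
  simp only [pderiv_slice hΦ, (hasDerivAt_slice hΦ t _).deriv]
  rw [pderiv_slice (contDiff_fderiv_apply_const hΦ _)]
  convert hasDerivAt_slice (contDiff_fderiv_apply_const hΦ (0, Pi.single i 1)) t x using 1
  have hd : DifferentiableAt ℝ (fderiv ℝ Φ) (t, x) :=
    (hΦ.fderiv_right (m := ∞) (by simp)).differentiable (by simp) _
  have key : ∀ u w, fderiv ℝ (fun q => fderiv ℝ Φ q w) (t, x) u =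
      fderiv ℝ (fderiv ℝ Φ) (t, x) u w := by
    intro u w
    simp [(hd.hasFDerivAt.clm_apply (hasFDerivAt_const w (t, x))).fderiv]
  rw [key, key]
  exact (hΦ.contDiffAt.isSymmSndFDerivAt
    (by simpa using WithTop.coe_le_coe.2 (le_top : (2 : ℕ∞) ≤ ⊤))) _ _

end time

/-- The spatial flux in the local energy balance of the Cahn–Hilliard–Navier–Stokes system,
where `φt` stands for the time derivative of `φ`. -/
noncomputable def energyFlux {d : ℕ} (γ : ℝ) (f m η : ℝ → ℝ) (φ φt μ p : (Fin d → ℝ) → ℝ)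
    (v : (Fin d → ℝ) → Fin d → ℝ) (j : Fin d) (y : Fin d → ℝ) : ℝ :=
  γ * (φt y * pderiv φ j y) + μ y * (m (φ y) * pderiv μ j y) +
    ∑ i, v y i * (η (φ y) * symGrad v i j y) -
    v y j * (1 / 2 * ∑ i, v y i ^ 2 + p y + γ / 2 * ∑ i, pderiv φ i y ^ 2 + f (φ y))

section flux

variable {d : ℕ} {γ : ℝ} {f m η : ℝ → ℝ} {φ φt μ p : (Fin d → ℝ) → ℝ}
  {v : (Fin d → ℝ) → Fin d → ℝ}

theorem contDiff_symGrad (hv : ∀ i, ContDiff ℝ ∞ fun y => v y i) (i j : Fin d) :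
    ContDiff ℝ ∞ (symGrad v i j) :=
  contDiff_const.mul (((hv i).pderiv_infty j).add ((hv j).pderiv_infty i))

theorem ZdPeriodic.apply (hv : ZdPeriodic v) (i : Fin d) : ZdPeriodic fun y => v y i :=
  fun x k => congrFun (hv x k) i

theorem ZdPeriodic.symGrad (hv : ZdPeriodic v) (i j : Fin d) : ZdPeriodic (symGrad v i j) := by
  intro x k
  simp only [_root_.symGrad]
  rw [(hv.apply i).pderiv j x k, (hv.apply j).pderiv i x k]

theorem contDiff_energyFlux (hf : ContDiff ℝ 1 f) (hm : ContDiff ℝ 1 m) (hη : ContDiff ℝ 1 η)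
    (hφ : ContDiff ℝ ∞ φ) (hφt : ContDiff ℝ ∞ φt) (hμ : ContDiff ℝ ∞ μ) (hp : ContDiff ℝ ∞ p)
    (hv : ∀ i, ContDiff ℝ ∞ fun y => v y i) (j : Fin d) :
    ContDiff ℝ 1 (energyFlux γ f m η φ φt μ p v j) := by
  have hle : (1 : WithTop ℕ∞) ≤ ∞ := by simp
  have hS := fun i => (contDiff_symGrad hv i j).of_le hle
  have hdφ := fun i => (hφ.pderiv_infty i).of_le hle
  have hdμ := (hμ.pderiv_infty j).of_le hle
  replace hv := fun i => (hv i).of_le hle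
  replace hφ := hφ.of_le hle
  replace hφt := hφt.of_le hle
  replace hμ := hμ.of_le hle
  replace hp := hp.of_le hle
  have hfφ := hf.comp hφ
  have hmφ := hm.comp hφ
  have hηφ := hη.comp hφ
  exact (((contDiff_const.mul (hφt.mul (hdφ j))).add (hμ.mul (hmφ.mul hdμ))).add
    (ContDiff.sum fun i _ => (hv i).mul (hηφ.mul (hS i)))).sub
    ((hv j).mul ((((contDiff_const.mul (ContDiff.sum fun i _ => (hv i).pow 2)).add hp).add
      (contDiff_const.mul (ContDiff.sum fun i _ => (hdφ i).pow 2))).add hfφ))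

theorem zdPeriodic_energyFlux (hφ : ZdPeriodic φ) (hφt : ZdPeriodic φt) (hμ : ZdPeriodic μ)
    (hp : ZdPeriodic p) (hv : ZdPeriodic v) (j : Fin d) :
    ZdPeriodic (energyFlux γ f m η φ φt μ p v j) := by
  intro x k
  simp only [energyFlux, hφ x k, hφt x k, hμ x k, hp x k, hv x k, hφ.pderiv _ x k,
    hμ.pderiv _ x k, hv.symGrad _ _ x k]

theorem pderiv_energyFlux (hf : ContDiff ℝ 1 f) (hm : ContDiff ℝ 1 m) (hη : ContDiff ℝ 1 η)
    (hφ : ContDiff ℝ ∞ φ) (hφt : ContDiff ℝ ∞ φt) (hμ : ContDiff ℝ ∞ μ) (hp : ContDiff ℝ ∞ p)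
    (hv : ∀ i, ContDiff ℝ ∞ fun y => v y i) (j : Fin d) (x : Fin d → ℝ) :
    pderiv (energyFlux γ f m η φ φt μ p v j) j x =
      γ * (pderiv φt j x * pderiv φ j x + φt x * pderiv (pderiv φ j) j x) +
      (pderiv μ j x * (m (φ x) * pderiv μ j x) +
        μ x * pderiv (fun y => m (φ y) * pderiv μ j y) j x) +
      ∑ i, (pderiv (fun y => v y i) j x * (η (φ x) * symGrad v i j x) +
        v x i * pderiv (fun y => η (φ y) * symGrad v i j y) j x) -
      (pderiv (fun y => v y j) j x *
        (1 / 2 * ∑ i, v x i ^ 2 + p x + γ / 2 * ∑ i, pderiv φ i x ^ 2 + f (φ x)) +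
        v x j * (∑ i, v x i * pderiv (fun y => v y i) j x + pderiv p j x +
          γ * ∑ i, pderiv φ i x * pderiv (pderiv φ i) j x +
          deriv f (φ x) * pderiv φ j x)) := by
  have hne : (∞ : WithTop ℕ∞) ≠ 0 := by simp
  have dS := fun i => (contDiff_symGrad hv i j).differentiable hne x
  have ddφ := fun i => (hφ.pderiv_infty i).differentiable hne x
  have ddμ := (hμ.pderiv_infty j).differentiable hne x
  have dv := fun i => (hv i).differentiable hne x
  have dφ := hφ.differentiable hne x
  have dφt := hφt.differentiable hne x
  have dμ := hμ.differentiable hne x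
  have dp := hp.differentiable hne x
  have df := hf.differentiable one_ne_zero (φ x)
  have dfφ : DifferentiableAt ℝ (fun y => f (φ y)) x := df.comp x dφ
  have dmφ : DifferentiableAt ℝ (fun y => m (φ y)) x :=
    (hm.differentiable one_ne_zero (φ x)).comp x dφ
  have dηφ : DifferentiableAt ℝ (fun y => η (φ y)) x :=
    (hη.differentiable one_ne_zero (φ x)).comp x dφ
  have dv2 : DifferentiableAt ℝ (fun y => ∑ i, v y i ^ 2) x :=
    DifferentiableAt.fun_sum fun i _ => (dv i).pow 2
  have dg2 : DifferentiableAt ℝ (fun y => ∑ i, pderiv φ i y ^ 2) x :=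
    DifferentiableAt.fun_sum fun i _ => (ddφ i).pow 2
  have dsum : DifferentiableAt ℝ (fun y => ∑ i, v y i * (η (φ y) * symGrad v i j y)) x :=
    DifferentiableAt.fun_sum fun i _ => (dv i).mul (dηφ.mul (dS i))
  have d1 := (dφt.fun_mul (ddφ j)).const_mul γ
  have d2 := dμ.fun_mul (dmφ.fun_mul ddμ)
  have d3 := (dv2.const_mul (1 / 2)).fun_add dp
  have d4 := d3.fun_add (dg2.const_mul (γ / 2))
  have d5 := d4.fun_add dfφ
  unfold energyFlux
  rw [pderiv_sub ((d1.fun_add d2).fun_add dsum) ((dv j).fun_mul d5),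
    pderiv_add (d1.fun_add d2) dsum, pderiv_add d1 d2, pderiv_const_mul (dφt.fun_mul (ddφ j)),
    pderiv_mul dφt (ddφ j), pderiv_mul dμ (dmφ.fun_mul ddμ),
    pderiv_sum fun i _ => (dv i).fun_mul (dηφ.fun_mul (dS i)), pderiv_mul (dv j) d5,
    pderiv_add d4 dfφ, pderiv_add d3 (dg2.const_mul (γ / 2)),
    pderiv_add (dv2.const_mul (1 / 2)) dp, pderiv_const_mul dv2, pderiv_const_mul dg2,
    pderiv_sum fun i _ => (dv i).fun_pow 2, pderiv_sum fun i _ => (ddφ i).fun_pow 2,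
    pderiv_comp df dφ]
  simp only [pderiv_mul (dv _) (dηφ.fun_mul (dS _)), pderiv_pow_two (dv _),
    pderiv_pow_two (ddφ _), ← Finset.mul_sum]
  ring

end flux

theorem integral_energy_rate_eq {d : ℕ} {γ : ℝ} {f m η : ℝ → ℝ} {φ φt μ p : (Fin d → ℝ) → ℝ}
    {v vt : (Fin d → ℝ) → Fin d → ℝ}
    (hf : ContDiff ℝ 1 f) (hm : ContDiff ℝ 1 m) (hη : ContDiff ℝ 1 η)
    (hφ : ContDiff ℝ ∞ φ) (hφt : ContDiff ℝ ∞ φt) (hμ : ContDiff ℝ ∞ μ) (hp : ContDiff ℝ ∞ p)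
    (hv : ∀ i, ContDiff ℝ ∞ fun y => v y i)
    (hφper : ZdPeriodic φ) (hφtper : ZdPeriodic φt) (hμper : ZdPeriodic μ)
    (hpper : ZdPeriodic p) (hvper : ZdPeriodic v)
    (hpde : ∀ x, φt x + ∑ i, pderiv (fun y => φ y * v y i) i x =
      ∑ i, pderiv (fun y => m (φ y) * pderiv μ i y) i x)
    (hchem : ∀ x, μ x = -γ * ∑ i, pderiv (pderiv φ i) i x + deriv f (φ x))
    (hmom : ∀ x i, vt x i + ∑ j, pderiv (fun y => v y i * v y j) j x -
      ∑ j, pderiv (fun y => η (φ y) * symGrad v i j y) j x + pderiv p i x +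
      ∑ j, pderiv (fun y => γ * pderiv φ i y * pderiv φ j y) j x = 0)
    (hdiv : ∀ x, ∑ i, pderiv (fun y => v y i) i x = 0) :
    ∫ x in Set.Icc (0 : Fin d → ℝ) 1, (γ * ∑ i, pderiv φ i x * pderiv φt i x +
        deriv f (φ x) * φt x + ∑ i, v x i * vt x i) =
      -(∫ x in Set.Icc (0 : Fin d → ℝ) 1, m (φ x) * ∑ i, pderiv μ i x ^ 2) -
        ∫ x in Set.Icc (0 : Fin d → ℝ) 1, η (φ x) * ∑ i, ∑ j, symGrad v i j x ^ 2 := by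
  have hne : (∞ : WithTop ℕ∞) ≠ 0 := by simp
  have dφ := fun x => hφ.differentiable hne x
  have ddφ := fun i x => (hφ.pderiv_infty i).differentiable hne x
  have dv := fun i x => (hv i).differentiable hne x
  have hflux := fun j => contDiff_energyFlux (γ := γ) hf hm hη hφ hφt hμ hp hv j
  have hpt : ∀ x, γ * ∑ i, pderiv φ i x * pderiv φt i x +
      deriv f (φ x) * φt x + ∑ i, v x i * vt x i =
      -(m (φ x) * ∑ i, pderiv μ i x ^ 2) - η (φ x) * ∑ i, ∑ j, symGrad v i j x ^ 2 +
      ∑ j, pderiv (energyFlux γ f m η φ φt μ p v j) j x := by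
    intro x
    simp only [pderiv_energyFlux hf hm hη hφ hφt hμ hp hv]
    refine energy_balance_algebra γ (m (φ x)) (η (φ x)) (φ x) (φt x) (μ x) (deriv f (φ x)) _
      (fun i => pderiv φ i x) (fun i => pderiv φt i x) (fun i => pderiv μ i x) _ _ _
      (fun i => pderiv p i x) (fun i j => pderiv (pderiv φ i) j x)
      (fun i j => pderiv (fun y => v y i) j x) _ (fun i j => symGrad v i j x)
      (fun i j => pderiv_comm hφ i j) (fun i j => rfl) ?_ (hchem x) (fun i => ?_) (hdiv x)
    · rw [← hpde x]
      simp only [pderiv_mul (dφ x) (dv _ x)]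
    · rw [← hmom x i]
      simp only [pderiv_mul (dv _ x) (dv _ x), mul_assoc]
      simp only [pderiv_const_mul ((ddφ _ x).fun_mul (ddφ _ x)), pderiv_mul (ddφ _ x) (ddφ _ x)]
  have hI : ∀ {g : (Fin d → ℝ) → ℝ}, Continuous g → IntegrableOn g (Set.Icc 0 1) :=
    fun hg => hg.continuousOn.integrableOn_compact isCompact_Icc
  have i1 : IntegrableOn (fun x => m (φ x) * ∑ i, pderiv μ i x ^ 2) (Set.Icc 0 1) :=
    hI ((hm.continuous.comp hφ.continuous).mul
      (continuous_finsetSum _ fun i _ => (hμ.pderiv_infty i).continuous.pow 2))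
  have i2 : IntegrableOn (fun x => η (φ x) * ∑ i, ∑ j, symGrad v i j x ^ 2) (Set.Icc 0 1) :=
    hI ((hη.continuous.comp hφ.continuous).mul
      (continuous_finsetSum _ fun i _ => continuous_finsetSum _ fun j _ =>
        (contDiff_symGrad hv i j).continuous.pow 2))
  have i3 : IntegrableOn (fun x => ∑ j, pderiv (energyFlux γ f m η φ φt μ p v j) j x)
      (Set.Icc 0 1) :=
    hI (continuous_finsetSum _ fun j _ =>
      ((hflux j).continuous_fderiv (by simp)).clm_apply continuous_const)
  simp only [hpt]
  have i4 : IntegrableOn (fun x => -(m (φ x) * ∑ i, pderiv μ i x ^ 2)) (Set.Icc 0 1) := i1.neg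
  have i5 : IntegrableOn (fun x => -(m (φ x) * ∑ i, pderiv μ i x ^ 2) -
      η (φ x) * ∑ i, ∑ j, symGrad v i j x ^ 2) (Set.Icc 0 1) := i4.sub i2
  rw [integral_add i5 i3, integral_sub i4 i2, integral_neg,
    integral_divergence_eq_zero hflux
      (fun j => zdPeriodic_energyFlux hφper hφtper hμper hpper hvper j), add_zero]

/-- Energy dissipation for the Cahn–Hilliard–Navier–Stokes system with
`ℤ^d`-periodic data:
`d/dt E₁(φ(t),v(t)) = −∫_Ω m(φ)|∇μ|² dx − ∫_Ω η(φ)|Dv|² dx ≤ 0`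
over the unit cube `Ω = [0,1]^d`. -/
theorem CHNS_energy_dissipation (d : ℕ) (hd : 1 ≤ d) (γ : ℝ) (hγ : 0 < γ)
    (f : ℝ → ℝ) (hf : ContDiff ℝ 2 f)
    (m η : ℝ → ℝ) (hm : ContDiff ℝ 1 m) (hη : ContDiff ℝ 1 η)
    (hm0 : ∀ s : ℝ, 0 ≤ m s) (hη0 : ∀ s : ℝ, 0 ≤ η s)
    (φ μ p : ℝ × (Fin d → ℝ) → ℝ) (v : ℝ × (Fin d → ℝ) → Fin d → ℝ)
    (hφ : ContDiff ℝ (⊤ : ℕ∞) φ) (hμ : ContDiff ℝ (⊤ : ℕ∞) μ) (hp : ContDiff ℝ (⊤ : ℕ∞) p)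
    (hv : ContDiff ℝ (⊤ : ℕ∞) v)
    (hφper : ∀ t : ℝ, ZdPeriodic fun x => φ (t, x))
    (hμper : ∀ t : ℝ, ZdPeriodic fun x => μ (t, x))
    (hpper : ∀ t : ℝ, ZdPeriodic fun x => p (t, x))
    (hvper : ∀ t : ℝ, ZdPeriodic fun x => v (t, x))
    (hpde : ∀ (t : ℝ) (x : Fin d → ℝ),
      deriv (fun s => φ (s, x)) t +
        ∑ i, pderiv (fun y => φ (t, y) * v (t, y) i) i x =
        ∑ i, pderiv (fun y => m (φ (t, y)) * pderiv (fun z => μ (t, z)) i y) i x)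
    (hchem : ∀ (t : ℝ) (x : Fin d → ℝ),
      μ (t, x) =
        -γ * ∑ i, pderiv (pderiv (fun z => φ (t, z)) i) i x + deriv f (φ (t, x)))
    (hmom : ∀ (t : ℝ) (x : Fin d → ℝ) (i : Fin d),
      deriv (fun s => v (s, x) i) t +
        ∑ j, pderiv (fun y => v (t, y) i * v (t, y) j) j x -
        ∑ j, pderiv (fun y => η (φ (t, y)) * symGrad (fun z => v (t, z)) i j y) j x +
        pderiv (fun z => p (t, z)) i x +
        ∑ j, pderiv
          (fun y => γ * pderiv (fun z => φ (t, z)) i y * pderiv (fun z => φ (t, z)) j y)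
          j x = 0)
    (hdiv : ∀ (t : ℝ) (x : Fin d → ℝ),
      ∑ i, pderiv (fun y => v (t, y) i) i x = 0) :
    ∀ t : ℝ,
      HasDerivAt
        (fun s => ∫ x in Set.Icc (0 : Fin d → ℝ) 1,
          (γ / 2 * ∑ i, (pderiv (fun z => φ (s, z)) i x) ^ 2 + f (φ (s, x)) +
            1 / 2 * ∑ i, (v (s, x) i) ^ 2))
        (-(∫ x in Set.Icc (0 : Fin d → ℝ) 1,
            m (φ (t, x)) * ∑ i, (pderiv (fun z => μ (t, z)) i x) ^ 2) -
          ∫ x in Set.Icc (0 : Fin d → ℝ) 1,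
            η (φ (t, x)) * ∑ i, ∑ j, (symGrad (fun z => v (t, z)) i j x) ^ 2) t ∧
      (-(∫ x in Set.Icc (0 : Fin d → ℝ) 1,
            m (φ (t, x)) * ∑ i, (pderiv (fun z => μ (t, z)) i x) ^ 2) -
          ∫ x in Set.Icc (0 : Fin d → ℝ) 1,
            η (φ (t, x)) * ∑ i, ∑ j, (symGrad (fun z => v (t, z)) i j x) ^ 2) ≤ 0 := by
  intro t
  have hφt := contDiff_deriv_slice hφ t
  have hv' : ∀ i, ContDiff ℝ ∞ fun q => v q i := fun i => contDiff_pi.1 hv i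
  have hslice : ContDiff ℝ ∞ fun x : Fin d → ℝ => (t, x) := contDiff_const.prodMk contDiff_id
  have hf1 : ContDiff ℝ 1 f := hf.of_le (by norm_num)
  have hle : (1 : WithTop ℕ∞) ≤ ∞ := by simp
  have hφtper : ZdPeriodic fun x => deriv (fun s => φ (s, x)) t := fun x k =>
    congrArg (deriv · t) (funext fun s => hφper s x k)
  have hrate := integral_energy_rate_eq hf1 hm hη (hφ.comp hslice) hφt (hμ.comp hslice)
    (hp.comp hslice) (fun i => (hv' i).comp hslice) (hφper t) hφtper (hμper t) (hpper t)
    (hvper t) (hpde t) (hchem t) (hmom t) (hdiv t)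
  constructor
  · have hG : ContDiff ℝ 1 fun q : ℝ × (Fin d → ℝ) =>
        γ / 2 * ∑ i, (pderiv (fun z => φ (q.1, z)) i q.2) ^ 2 + f (φ (q.1, q.2)) +
          1 / 2 * ∑ i, (v (q.1, q.2) i) ^ 2 := by
      simp only [pderiv_slice hφ]
      exact ((contDiff_const.mul (ContDiff.sum fun i _ =>
        ((contDiff_fderiv_apply_const hφ _).of_le hle).pow 2)).add
        (hf1.comp (hφ.of_le hle))).add
        (contDiff_const.mul (ContDiff.sum fun i _ => ((hv' i).of_le hle).pow 2))
    refine (hasDerivAt_setIntegral_of_contDiff (ν := volume) hG isCompact_Icc t).congr_deriv ?_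
    refine Eq.trans (integral_congr_ae (.of_forall fun x => HasDerivAt.deriv ?_)) hrate
    have h1 := (HasDerivAt.fun_sum fun i (_ : i ∈ Finset.univ) =>
      (hasDerivAt_pderiv_slice hφ t x i).fun_pow 2).const_mul (γ / 2)
    have h2 := (hf1.differentiable one_ne_zero (φ (t, x))).hasDerivAt.comp t
      (hasDerivAt_slice hφ t x).differentiableAt.hasDerivAt
    have h3 := (HasDerivAt.fun_sum fun i (_ : i ∈ Finset.univ) =>
      (hasDerivAt_slice (hv' i) t x).differentiableAt.hasDerivAt.fun_pow 2).const_mul (1 / 2)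
    refine ((h1.add h2).add h3).congr_deriv ?_
    simp only [Function.comp_def, Nat.cast_ofNat, Nat.add_one_sub_one, pow_one, mul_assoc,
      ← Finset.mul_sum]
    ring
  · have n1 : 0 ≤ ∫ x in Set.Icc (0 : Fin d → ℝ) 1,
        m (φ (t, x)) * ∑ i, (pderiv (fun z => μ (t, z)) i x) ^ 2 :=
      integral_nonneg fun x => mul_nonneg (hm0 _) (Finset.sum_nonneg fun i _ => sq_nonneg _)
    have n2 : 0 ≤ ∫ x in Set.Icc (0 : Fin d → ℝ) 1,
        η (φ (t, x)) * ∑ i, ∑ j, (symGrad (fun z => v (t, z)) i j x) ^ 2 :=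
      integral_nonneg fun x => mul_nonneg (hη0 _)
        (Finset.sum_nonneg fun i _ => Finset.sum_nonneg fun j _ => sq_nonneg _)
    linarith
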